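/- Fix integers 0 < d < n and set r = d*(n−d). The map sending a cylindrical growth diagram γ to the chain (γ(0,0), γ(0,1), …, γ(0,r)) is a bijection from the set of cylindrical growth diagrams onto the set of chains ∅ = α₀ ⊆ α₁ ⊆ ⋯ ⊆ α_r = R of Young diagrams in Λ(d,n) in which each α_{k+1} is obtained from α_k by adding one box (that is, onto the set of standard Young tableaux of rectangular shape R). -/

import Mathlib

/-- `ν` is obtained from `μ` by adding one box. -/
def AddBox (μ ν : YoungDiagram) : Prop := μ ≤ ν ∧ ν.card = μ.card + 1

/-- Two cells of `ℕ × ℕ` are adjacent: `|a−a'| + |b−b'| = 1`. -/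
def CellAdj (c c' : ℕ × ℕ) : Prop :=
  |(c.1 : ℤ) - (c'.1 : ℤ)| + |(c.2 : ℤ) - (c'.2 : ℤ)| = 1

/-- `μ ∈ Λ(d,n)`: every cell `(i,j)` of `μ` has `i < d` and `j < n−d`. -/
def InLambda (d n : ℕ) (μ : YoungDiagram) : Prop :=
  ∀ c ∈ μ.cells, c.1 < d ∧ c.2 < n - d

/-- The full `d × m` rectangular Young diagram. -/
def rectYD (d m : ℕ) : YoungDiagram where
  cells := Finset.range d ×ˢ Finset.range m
  isLowerSet := by
    intro a b hba ha
    simp only [Finset.coe_product, Set.mem_prod, Finset.mem_coe, Finset.mem_range] at ha ⊢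
    exact ⟨lt_of_le_of_lt hba.1 ha.1, lt_of_le_of_lt hba.2 ha.2⟩

/-- A cylindrical growth diagram for the parameters `d < n`, with `r = d*(n−d)`:
a map `γ` on `𝕀 = {(i,j) : i ≤ j ≤ i + r}` (normalized to `⊥` off `𝕀`) valued in
`Λ(d,n)`, such that `γ i j` has `j − i` cells, `γ i (j+1)` and `γ (i−1) j` are
obtained from `γ i j` by adding one box, and whenever the two cells of
`γ (i−1) (j+1) \ γ i j` are nonadjacent, `γ i (j+1) ≠ γ (i−1) j`. -/
structure CGD (d n : ℕ) where
  γ : ℤ → ℤ → YoungDiagram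
  junk : ∀ i j : ℤ, ¬ (i ≤ j ∧ j ≤ i + ((d * (n - d) : ℕ) : ℤ)) → γ i j = ⊥
  lambda : ∀ i j : ℤ, i ≤ j → j ≤ i + ((d * (n - d) : ℕ) : ℤ) → InLambda d n (γ i j)
  card_eq : ∀ i j : ℤ, i ≤ j → j ≤ i + ((d * (n - d) : ℕ) : ℤ) →
    ((γ i j).card : ℤ) = j - i
  grow_right : ∀ i j : ℤ, i ≤ j → j + 1 ≤ i + ((d * (n - d) : ℕ) : ℤ) →
    AddBox (γ i j) (γ i (j + 1))
  grow_up : ∀ i j : ℤ, i ≤ j → j ≤ (i - 1) + ((d * (n - d) : ℕ) : ℤ) →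
    AddBox (γ i j) (γ (i - 1) j)
  nonadj : ∀ i j : ℤ, i ≤ j → j + 1 ≤ (i - 1) + ((d * (n - d) : ℕ) : ℤ) →
    (∃ c₁ ∈ (γ (i - 1) (j + 1)).cells \ (γ i j).cells,
      ∃ c₂ ∈ (γ (i - 1) (j + 1)).cells \ (γ i j).cells, c₁ ≠ c₂ ∧ ¬ CellAdj c₁ c₂) →
    γ i (j + 1) ≠ γ (i - 1) j

/-- The skew shape `ν / μ` contains two distinct nonadjacent cells. -/
def HasNonadjCells (μ ν : YoungDiagram) : Prop :=
  ∃ c₁ ∈ ν.cells \ μ.cells, ∃ c₂ ∈ ν.cells \ μ.cells, c₁ ≠ c₂ ∧ ¬ CellAdj c₁ c₂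

theorem AddBox.exists_insert {μ ν : YoungDiagram} (h : AddBox μ ν) :
    ∃ c ∉ μ.cells, ν.cells = insert c μ.cells := by
  obtain ⟨c, hc, he⟩ := (Finset.covBy_iff_card_sdiff_eq_one.2
    ⟨YoungDiagram.cells_subset_iff.2 h.1, by
      have h1 := Finset.card_sdiff_add_card_eq_card (YoungDiagram.cells_subset_iff.2 h.1)
      have h2 := h.2
      simp only [YoungDiagram.card] at h2
      omega⟩).exists_finset_insert
  exact ⟨c, hc, he.symm⟩

theorem addBox_of_cells_eq_insert {μ ν : YoungDiagram} {c : ℕ × ℕ} (hc : c ∉ μ.cells)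
    (h : ν.cells = insert c μ.cells) : AddBox μ ν := by
  refine ⟨YoungDiagram.cells_subset_iff.1 (h ▸ Finset.subset_insert _ _), ?_⟩
  simp only [YoungDiagram.card, h, Finset.card_insert_of_notMem hc]

theorem eq_of_le_of_card_eq {μ ν : YoungDiagram} (h : μ ≤ ν) (hc : μ.card = ν.card) : μ = ν :=
  YoungDiagram.ext (Finset.eq_of_subset_of_card_le (YoungDiagram.cells_subset_iff.2 h) hc.ge)

theorem mem_cells_of_le {μ : YoungDiagram} {c c' : ℕ × ℕ} (h : c ≤ c') (hc : c' ∈ μ.cells) :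
    c ∈ μ.cells :=
  μ.isLowerSet h hc

/-- If `ν / μ = {c, c'}` with `c < c'`, then `c` and `c'` are adjacent. -/
theorem cellAdj_of_le {μ ν : YoungDiagram} {c c' : ℕ × ℕ} (hne : c ≠ c') (hle : c ≤ c')
    (hc : c ∉ μ.cells) (hν : ν.cells = insert c' (insert c μ.cells)) : CellAdj c c' := by
  obtain ⟨a, b⟩ := c
  obtain ⟨a', b'⟩ := c'
  have key : ∀ x y, a ≤ x → b ≤ y → x ≤ a' → y ≤ b' →
      (x, y) = (a', b') ∨ (x, y) = (a, b) := by
    intro x y h1 h2 h3 h4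
    have hx : (x, y) ∈ ν.cells :=
      mem_cells_of_le (c' := (a', b')) ⟨h3, h4⟩ (by rw [hν]; exact Finset.mem_insert_self _ _)
    have hx' : (x, y) ∉ μ.cells := fun h => hc (mem_cells_of_le (c := (a, b)) ⟨h1, h2⟩ h)
    rw [hν, Finset.mem_insert, Finset.mem_insert] at hx
    tauto
  obtain ⟨h1, h2⟩ : a ≤ a' ∧ b ≤ b' := hle
  simp only [Prod.mk.injEq, ne_eq] at key hne
  have k1 := key a b' le_rfl h2 h1 le_rfl
  simp only [CellAdj]
  by_cases ha : a = a'
  · have k2 := key a (b + 1) le_rfl (by omega) h1 (by omega)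
    have : b' = b + 1 := by omega
    subst ha this
    simp
  · have k2 := key (a + 1) b (by omega) le_rfl (by omega) h2
    have : a' = a + 1 ∧ b = b' := by omega
    obtain ⟨rfl, rfl⟩ := this
    simp

theorem CellAdj.symm {c c' : ℕ × ℕ} (h : CellAdj c c') : CellAdj c' c := by
  unfold CellAdj at *
  rw [abs_sub_comm (c'.1 : ℤ), abs_sub_comm (c'.2 : ℤ)]
  exact h

theorem CellAdj.le_or_le {c c' : ℕ × ℕ} (h : CellAdj c c') : c ≤ c' ∨ c' ≤ c := by
  unfold CellAdj at h
  simp only [Prod.le_def]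
  rcases abs_cases ((c.1 : ℤ) - c'.1) with h1 | h1 <;>
    rcases abs_cases ((c.2 : ℤ) - c'.2) with h2 | h2 <;> omega

/-- The local rule: `κ'` is the partner of `κ` in the interval `[μ, ν]`. -/
def LocalRule (μ ν κ κ' : YoungDiagram) : Prop :=
  AddBox μ κ' ∧ AddBox κ' ν ∧ (HasNonadjCells μ ν → κ ≠ κ')

/-- The local rule determines a unique fourth corner of each square. -/
theorem existsUnique_localRule {μ ν κ : YoungDiagram} (h1 : AddBox μ κ) (h2 : AddBox κ ν) :
    ∃! κ', LocalRule μ ν κ κ' := by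
  obtain ⟨c, hc, hκ⟩ := h1.exists_insert
  obtain ⟨c', hc', hν⟩ := h2.exists_insert
  rw [hκ] at hν hc'
  have hne : c ≠ c' := by rintro rfl; exact hc' (Finset.mem_insert_self _ _)
  have hcμ' : c' ∉ μ.cells := fun h => hc' (Finset.mem_insert_of_mem h)
  have hdiff : ν.cells \ μ.cells = {c, c'} := by
    rw [hν]; ext x
    simp only [Finset.mem_sdiff, Finset.mem_insert, Finset.mem_singleton]
    constructor
    · tauto
    · rintro (rfl | rfl) <;> tauto
  have mid : ∀ κ', AddBox μ κ' → AddBox κ' ν →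
      κ'.cells = insert c μ.cells ∨ κ'.cells = insert c' μ.cells := by
    intro κ' h3 h4
    obtain ⟨x, hx, hκ'⟩ := h3.exists_insert
    have : x ∈ ν.cells \ μ.cells := Finset.mem_sdiff.2
      ⟨YoungDiagram.cells_subset_iff.2 h4.1 (hκ' ▸ Finset.mem_insert_self _ _), hx⟩
    rw [hdiff, Finset.mem_insert, Finset.mem_singleton] at this
    rcases this with rfl | rfl
    · exact Or.inl hκ'
    · exact Or.inr hκ'
  by_cases hadj : CellAdj c c'
  · have hnot : ¬ HasNonadjCells μ ν := by
      rintro ⟨x, hx, y, hy, hxy, hn⟩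
      rw [hdiff, Finset.mem_insert, Finset.mem_singleton] at hx hy
      rcases hx with rfl | rfl <;> rcases hy with rfl | rfl
      · exact hxy rfl
      · exact hn hadj
      · exact hn hadj.symm
      · exact hxy rfl
    refine ⟨κ, ⟨h1, h2, fun h => (hnot h).elim⟩, ?_⟩
    rintro κ' ⟨h3, h4, -⟩
    rcases mid κ' h3 h4 with h | h
    · exact YoungDiagram.ext (h.trans hκ.symm)
    · exfalso
      rcases hadj.le_or_le with hl | hl
      · have : c ∈ κ'.cells := mem_cells_of_le hl (h ▸ Finset.mem_insert_self _ _)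
        rw [h, Finset.mem_insert] at this
        tauto
      · have : c' ∈ κ.cells := mem_cells_of_le hl (hκ ▸ Finset.mem_insert_self _ _)
        rw [hκ] at this
        exact hc' this
  · have hlow : IsLowerSet (insert c' μ.cells : Set (ℕ × ℕ)) := by
      intro x y hyx hx
      rcases hx with rfl | hx
      · have hy : y ∈ ν.cells := mem_cells_of_le hyx (hν ▸ Finset.mem_insert_self _ _)
        rw [hν, Finset.mem_insert, Finset.mem_insert] at hy
        rcases hy with rfl | rfl | hy
        · exact Or.inl rfl
        · exact (hadj (cellAdj_of_le hne hyx hc hν)).elim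
        · exact Or.inr hy
      · exact Or.inr (mem_cells_of_le hyx hx)
    have hnon : HasNonadjCells μ ν :=
      ⟨c, by simp [hdiff], c', by simp [hdiff], hne, hadj⟩
    refine ⟨⟨insert c' μ.cells, by rwa [Finset.coe_insert]⟩,
      ⟨addBox_of_cells_eq_insert hcμ' rfl,
        addBox_of_cells_eq_insert (c := c) ?_ ?_, fun _ h => ?_⟩, ?_⟩
    · simp only [Finset.mem_insert]; tauto
    · rw [hν, Finset.insert_comm]
    · rw [h] at hκ
      exact hc' (hκ ▸ Finset.mem_insert_self _ _)
    · rintro κ' ⟨h3, h4, h5⟩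
      rcases mid κ' h3 h4 with h | h
      · exact (h5 hnon (YoungDiagram.ext (hκ.trans h.symm))).elim
      · exact YoungDiagram.ext h

/-- Saturated chains of length `r` from `⊥` to `R`, extended by `⊥` beyond index `r`. -/
structure SatChain (r : ℕ) (R : YoungDiagram) where
  /-- The terms of the chain. -/
  seq : ℕ → YoungDiagram
  zero : seq 0 = ⊥
  last : seq r = R
  step : ∀ k < r, AddBox (seq k) (seq (k + 1))
  junk : ∀ k, r < k → seq k = ⊥

namespace SatChain

variable {r : ℕ} {R : YoungDiagram}

theorem ext_of_le {a b : SatChain r R} (h : ∀ k ≤ r, a.seq k = b.seq k) : a = b := by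
  have : a.seq = b.seq := by
    funext k
    rcases le_or_gt k r with hk | hk
    · exact h k hk
    · rw [a.junk k hk, b.junk k hk]
  cases a; cases b; simp_all

theorem card_seq (a : SatChain r R) : ∀ k ≤ r, (a.seq k).card = k
  | 0, _ => by rw [a.zero]; rfl
  | k + 1, hk => by rw [(a.step k hk).2, a.card_seq k (by omega)]

theorem seq_le (a : SatChain r R) {k : ℕ} (hk : k ≤ r) : a.seq k ≤ R := by
  induction hk using Nat.decreasingInduction with
  | self => exact a.last.le
  | of_succ k hk ih => exact (a.step k hk).1.trans ih

/-- `b` can be the row following `a` in a growth diagram. -/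
def Rel (a b : SatChain r R) : Prop :=
  (∀ k < r, AddBox (b.seq k) (a.seq (k + 1))) ∧
    ∀ k, k + 2 ≤ r → HasNonadjCells (b.seq k) (a.seq (k + 2)) → b.seq (k + 1) ≠ a.seq (k + 1)

theorem Rel.localRule {a b : SatChain r R} (h : Rel a b) {k : ℕ} (hk : k + 2 ≤ r) :
    LocalRule (b.seq k) (a.seq (k + 2)) (a.seq (k + 1)) (b.seq (k + 1)) :=
  ⟨b.step k (by omega), h.1 (k + 1) (by omega), fun hn => (h.2 k hk hn).symm⟩

theorem Rel.localRule' {a b : SatChain r R} (h : Rel a b) {k : ℕ} (hk : k + 2 ≤ r) :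
    LocalRule (b.seq k) (a.seq (k + 2)) (b.seq (k + 1)) (a.seq (k + 1)) :=
  ⟨h.1 k (by omega), a.step (k + 1) (by omega), h.2 k hk⟩

theorem Rel.right_unique {a b b' : SatChain r R} (h : Rel a b) (h' : Rel a b') : b = b' := by
  refine ext_of_le fun k => ?_
  induction k with
  | zero => intro; rw [b.zero, b'.zero]
  | succ k ih =>
    intro hk
    rcases hk.lt_or_eq with hk | rfl
    · have hb := h'.localRule hk
      rw [← ih (by omega)] at hb
      exact (existsUnique_localRule (h.localRule' hk).1 (h.localRule' hk).2.1).unique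
        (h.localRule hk) hb
    · rw [b.last, b'.last]

theorem Rel.left_unique {a a' b : SatChain r R} (h : Rel a b) (h' : Rel a' b) : a = a' := by
  refine ext_of_le fun k hk => ?_
  induction hk using Nat.decreasingInduction with
  | self => rw [a.last, a'.last]
  | of_succ k hk ih =>
    rcases k with _ | k
    · rw [a.zero, a'.zero]
    · have ha := h'.localRule' hk
      rw [← ih] at ha
      exact (existsUnique_localRule (h.localRule hk).1 (h.localRule hk).2.1).unique
        (h.localRule' hk) ha

open Classical in
/-- The partner of `κ` in `[μ, ν]`, when it exists. -/
noncomputable def toggle (μ ν κ : YoungDiagram) : YoungDiagram :=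
  if h : ∃ κ', LocalRule μ ν κ κ' then h.choose else ⊥

theorem toggle_spec {μ ν κ : YoungDiagram} (h1 : AddBox μ κ) (h2 : AddBox κ ν) :
    LocalRule μ ν κ (toggle μ ν κ) := by
  have h := (existsUnique_localRule h1 h2).exists
  rw [toggle, dif_pos h]
  exact h.choose_spec

/-- The terms, except for the last one, of the row following `a`. -/
noncomputable def nextSeq (a : ℕ → YoungDiagram) : ℕ → YoungDiagram
  | 0 => ⊥
  | k + 1 => toggle (nextSeq a k) (a (k + 2)) (a (k + 1))

/-- The terms, except for the first one, of the row preceding `b`, in decreasing order. -/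
noncomputable def prevSeq (r : ℕ) (b : ℕ → YoungDiagram) : ℕ → YoungDiagram
  | 0 => b r
  | m + 1 => toggle (b (r - m - 2)) (prevSeq r b m) (b (r - m - 1))

theorem addBox_nextSeq (a : SatChain r R) : ∀ k < r, AddBox (nextSeq a.seq k) (a.seq (k + 1))
  | 0, hk => by simpa only [nextSeq, a.zero] using a.step 0 hk
  | k + 1, hk => (toggle_spec (addBox_nextSeq a k (by omega)) (a.step (k + 1) hk)).2.1

theorem addBox_prevSeq (b : SatChain r R) :
    ∀ m < r, AddBox (b.seq (r - m - 1)) (prevSeq r b.seq m)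
  | 0, hm => by
    have := b.step (r - 1) (by omega)
    rwa [Nat.sub_add_cancel (by omega)] at this
  | m + 1, hm => by
    have h := b.step (r - m - 2) (by omega)
    rw [show r - m - 2 + 1 = r - m - 1 by omega] at h
    exact (toggle_spec h (addBox_prevSeq b m (by omega))).1

theorem exists_rel_right (hr : 0 < r) (a : SatChain r R) : ∃ b, Rel a b := by
  have hadd := addBox_nextSeq a
  have hspec : ∀ k, k + 2 ≤ r → LocalRule (nextSeq a.seq k) (a.seq (k + 2)) (a.seq (k + 1))
      (nextSeq a.seq (k + 1)) := fun k hk =>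
    toggle_spec (hadd k (by omega)) (a.step (k + 1) (by omega))
  let s : ℕ → YoungDiagram := fun k => if k < r then nextSeq a.seq k else if k = r then R else ⊥
  have hs : ∀ k < r, s k = nextSeq a.seq k := fun k hk => if_pos hk
  have hlast : s r = R := by simp [s]
  refine ⟨⟨s, hs 0 hr, hlast, fun k hk => ?_, fun k hk => ?_⟩, fun k hk => ?_, fun k hk => ?_⟩
  · rcases Nat.lt_or_ge (k + 1) r with h | h
    · rw [hs k hk, hs (k + 1) h]
      exact (hspec k h).1
    · obtain rfl : r = k + 1 := by omega
      rw [hs k hk, hlast]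
      simpa only [a.last] using hadd k hk
  · simp only [s]
    rw [if_neg (by omega), if_neg (by omega)]
  · simp only [hs k hk]
    exact hadd k hk
  · simp only [hs k (by omega), hs (k + 1) (by omega)]
    exact fun h => ((hspec k hk).2.2 h).symm

theorem exists_rel_left (hr : 0 < r) (b : SatChain r R) : ∃ a, Rel a b := by
  have hadd : ∀ k < r, AddBox (b.seq k) (prevSeq r b.seq (r - (k + 1))) := fun k hk => by
    have := addBox_prevSeq b (r - (k + 1)) (by omega)
    rwa [show r - (r - (k + 1)) - 1 = k by omega] at this
  have hspec : ∀ k, k + 2 ≤ r → LocalRule (b.seq k) (prevSeq r b.seq (r - (k + 2)))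
      (b.seq (k + 1)) (prevSeq r b.seq (r - (k + 1))) := fun k hk => by
    rw [show r - (k + 1) = r - (k + 2) + 1 by omega, prevSeq,
      show r - (r - (k + 2)) - 2 = k by omega, show r - (r - (k + 2)) - 1 = k + 1 by omega]
    exact toggle_spec (b.step k (by omega)) (hadd (k + 1) (by omega))
  let s : ℕ → YoungDiagram := fun k =>
    if k = 0 then ⊥ else if k ≤ r then prevSeq r b.seq (r - k) else ⊥
  have hs : ∀ k < r, s (k + 1) = prevSeq r b.seq (r - (k + 1)) := fun k hk => if_pos hk
  refine ⟨⟨s, rfl, ?_, fun k hk => ?_, fun k hk => ?_⟩, fun k hk => ?_, fun k hk => ?_⟩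
  · simp [s, hr.ne', prevSeq, b.last]
  · rw [hs k hk]
    rcases k with _ | k
    · rw [show s 0 = b.seq 0 from b.zero.symm]
      exact hadd 0 hk
    · rw [hs k (by omega)]
      exact (hspec k hk).2.1
  · simp only [s]
    rw [if_neg (by omega), if_neg (by omega)]
  · simp only [hs k hk]
    exact hadd k hk
  · simp only [hs k (by omega), hs (k + 1) (by omega)]
    exact (hspec k hk).2.2

/-- Passing to the next row is a permutation of the set of saturated chains. -/
theorem exists_perm (hr : 0 < r) (R : YoungDiagram) :
    ∃ e : Equiv.Perm (SatChain r R), ∀ a b, Rel a b ↔ e a = b := by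
  choose f hf using exists_rel_right (R := R) hr
  refine ⟨Equiv.ofBijective f ⟨fun a a' h => ?_, fun b => ?_⟩, fun a b => ⟨fun h => ?_, ?_⟩⟩
  · exact (hf a).left_unique (h ▸ hf a')
  · obtain ⟨a, ha⟩ := exists_rel_left hr b
    exact ⟨a, (hf a).right_unique ha⟩
  · exact (hf a).right_unique h
  · rintro rfl
    exact hf a

theorem zpow_apply_eq_of_rel {e : Equiv.Perm (SatChain r R)} (he : ∀ a b, Rel a b ↔ e a = b)
    {s : ℤ → SatChain r R} (hs : ∀ i, Rel (s i) (s (i + 1))) (i : ℤ) : s i = (e ^ i) (s 0) := by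
  have step : ∀ i, s (i + 1) = e (s i) := fun i => ((he _ _).1 (hs i)).symm
  induction i using Int.induction_on with
  | zero => rfl
  | succ i ih => rw [step, ih, add_comm, zpow_one_add, Equiv.Perm.mul_apply]
  | pred i ih =>
    apply e.injective
    rw [← step, sub_add_cancel, ih, ← Equiv.Perm.mul_apply, ← zpow_one_add]
    congr 2
    ring

end SatChain

theorem inLambda_iff_le_rectYD {d n : ℕ} {μ : YoungDiagram} :
    InLambda d n μ ↔ μ ≤ rectYD d (n - d) := by
  rw [← YoungDiagram.cells_subset_iff]
  simp [InLambda, rectYD, Finset.subset_iff]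

theorem card_rectYD (d m : ℕ) : (rectYD d m).card = d * m := by
  simp [YoungDiagram.card, rectYD]

namespace CGD

variable {d n : ℕ}

/-- The `i`-th row of a cylindrical growth diagram. -/
def row (g : CGD d n) (i : ℤ) : SatChain (d * (n - d)) (rectYD d (n - d)) where
  seq k := g.γ i (i + k)
  zero := by
    have h := g.card_eq i i le_rfl (by omega)
    rw [Nat.cast_zero, add_zero]
    refine (eq_of_le_of_card_eq bot_le ?_).symm
    have : (⊥ : YoungDiagram).card = 0 := rfl
    omega
  last := by
    refine eq_of_le_of_card_eq
      (inLambda_iff_le_rectYD.1 (g.lambda i _ (by omega) le_rfl)) ?_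
    have h := g.card_eq i (i + (d * (n - d) : ℕ)) (by omega) le_rfl
    rw [card_rectYD]
    omega
  step k hk := by
    have h := g.grow_right i (i + k) (by omega) (by omega)
    rwa [show i + (k : ℤ) + 1 = i + (k + 1 : ℕ) by push_cast; ring] at h
  junk k hk := g.junk _ _ (by omega)

theorem rel_row (g : CGD d n) (i : ℤ) : SatChain.Rel (g.row i) (g.row (i + 1)) := by
  refine ⟨fun k hk => ?_, fun k hk => ?_⟩
  · have h := g.grow_up (i + 1) (i + 1 + k) (by omega) (by omega)
    rw [add_sub_cancel_right] at h
    simp only [row]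
    rwa [show i + ((k + 1 : ℕ) : ℤ) = i + 1 + k by push_cast; ring]
  · have h := g.nonadj (i + 1) (i + 1 + k) (by omega) (by omega)
    rw [add_sub_cancel_right] at h
    simp only [row]
    rw [show i + ((k + 1 : ℕ) : ℤ) = i + 1 + k by push_cast; ring,
      show i + ((k + 2 : ℕ) : ℤ) = i + 1 + k + 1 by push_cast; ring,
      show i + 1 + ((k + 1 : ℕ) : ℤ) = i + 1 + k + 1 by push_cast; ring]
    exact h

theorem ext_row {g g' : CGD d n} (h : ∀ i, g.row i = g'.row i) : g = g' := by
  have : g.γ = g'.γ := by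
    funext i j
    by_cases hij : i ≤ j
    · have := congrFun (congrArg SatChain.seq (h i)) (j - i).toNat
      simp only [row] at this
      rwa [show i + ((j - i).toNat : ℤ) = j by omega] at this
    · rw [g.junk i j (by omega), g'.junk i j (by omega)]
  cases g; cases g'; simp_all

/-- The cylindrical growth diagram with prescribed rows. -/
def ofRows (s : ℤ → SatChain (d * (n - d)) (rectYD d (n - d)))
    (hs : ∀ i, SatChain.Rel (s i) (s (i + 1))) : CGD d n where
  γ i j := if i ≤ j then (s i).seq (j - i).toNat else ⊥
  junk i j h := by
    split_ifs with hij
    · exact (s i).junk _ (by omega)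
    · rfl
  lambda i j hij hj := by
    rw [if_pos hij]
    exact inLambda_iff_le_rectYD.2 ((s i).seq_le (by omega))
  card_eq i j hij hj := by
    rw [if_pos hij, (s i).card_seq _ (by omega)]
    omega
  grow_right i j hij hj := by
    rw [if_pos hij, if_pos (by omega), show (j + 1 - i).toNat = (j - i).toNat + 1 by omega]
    exact (s i).step _ (by omega)
  grow_up i j hij hj := by
    rw [if_pos hij, if_pos (by omega), show (j - (i - 1)).toNat = (j - i).toNat + 1 by omega]
    have h := (hs (i - 1)).1 (j - i).toNat (by omega)
    rwa [sub_add_cancel] at h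
  nonadj i j hij hj := by
    rw [if_pos hij, if_pos (by omega), if_pos (by omega), if_pos (by omega),
      show (j - (i - 1)).toNat = (j - i).toNat + 1 by omega,
      show (j + 1 - (i - 1)).toNat = (j - i).toNat + 2 by omega,
      show (j + 1 - i).toNat = (j - i).toNat + 1 by omega]
    have h := (hs (i - 1)).2 (j - i).toNat (by omega)
    rwa [sub_add_cancel] at h

end CGD

/-- **Cylindrical growth diagrams are in bijection with rectangular standard Young
tableaux.** Fix `0 < d < n`, `r = d*(n−d)`. The map sending a cylindrical growth
diagram `g` to the chain `(g.γ 0 0, g.γ 0 1, …, g.γ 0 r)` is a bijection onto the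
set of chains `∅ = α₀ ⊆ α₁ ⊆ ⋯ ⊆ α_r = R` of Young diagrams in which each term is
obtained from the previous by adding one box, i.e. onto the standard Young tableaux
of shape the `d × (n−d)` rectangle `R`. -/
theorem stmt4 (d n : ℕ) (hd : 0 < d) (hdn : d < n) :
    ∃ F : CGD d n → {α : Fin (d * (n - d) + 1) → YoungDiagram //
        α 0 = ⊥ ∧ α (Fin.last (d * (n - d))) = rectYD d (n - d) ∧
        ∀ k : Fin (d * (n - d)), AddBox (α k.castSucc) (α k.succ)},
      (∀ (g : CGD d n) (k : Fin (d * (n - d) + 1)), (F g).1 k = g.γ 0 ((k : ℕ) : ℤ)) ∧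
      Function.Bijective F := by
  have hr : 0 < d * (n - d) := Nat.mul_pos hd (by omega)
  obtain ⟨e, he⟩ := SatChain.exists_perm hr (rectYD d (n - d))
  have seq_row (g : CGD d n) (k : ℕ) : (g.row 0).seq k = g.γ 0 k := by simp [CGD.row]
  refine ⟨fun g => ⟨fun k => (g.row 0).seq k, (g.row 0).zero, (g.row 0).last,
    fun k => (g.row 0).step k k.2⟩, fun g k => seq_row g k, fun g g' h => ?_, ?_⟩
  · have h0 : g.row 0 = g'.row 0 := SatChain.ext_of_le fun k hk =>
      congrFun (congrArg Subtype.val h) ⟨k, Nat.lt_succ_of_le hk⟩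
    refine CGD.ext_row fun i => ?_
    rw [SatChain.zpow_apply_eq_of_rel he g.rel_row i,
      SatChain.zpow_apply_eq_of_rel he g'.rel_row i, h0]
  · rintro ⟨α, h0, hlast, hstep⟩
    let a : SatChain (d * (n - d)) (rectYD d (n - d)) :=
      { seq := fun k => if h : k < d * (n - d) + 1 then α ⟨k, h⟩ else ⊥
        zero := h0
        last := by rw [dif_pos (Nat.lt_succ_self _)]; exact hlast
        step := fun k hk => by
          rw [dif_pos (by omega), dif_pos (by omega)]
          exact hstep ⟨k, hk⟩
        junk := fun k hk => dif_neg (by omega) }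
    have hrel : ∀ i : ℤ, SatChain.Rel ((e ^ i) a) ((e ^ (i + 1)) a) := fun i => by
      rw [he, add_comm, zpow_one_add, Equiv.Perm.mul_apply]
    refine ⟨CGD.ofRows (fun i => (e ^ i) a) hrel, Subtype.ext (funext fun k => ?_)⟩
    simp [seq_row, CGD.ofRows, a, k.is_le.not_gt]
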